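/- Let (V,q) be a quadratic space over ℚ₂ of dimension d ≥ 3, and let L₁ and L₂ be odd unimodular lattices in (V,q) with Λᵢ = {x ∈ Lᵢ : q(x) ∈ 2ℤ₂} for i = 1,2. Then every isometry g of (V,q) with g(L₁) = L₂ satisfies g(Λ₁) = Λ₂. Consequently, if Λ₁ = Λ₂ = Λ, then there exists an isometry g of (V,q) with g(Λ) = Λ and g(L₁) = L₂. -/

import Mathlib

/-- The symmetric bilinear form `B_q(x,y) = (q(x+y) - q(x) - q(y))/2` associated to a
quadratic form `q` on a `ℚ₂`-vector space `V`. -/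
noncomputable def Bq {V : Type*} [AddCommGroup V] [Module ℚ_[2] V]
    (q : QuadraticForm ℚ_[2] V) (x y : V) : ℚ_[2] :=
  (q (x + y) - q x - q y) / 2

/-- An element `c : ℚ₂` lies in `ℤ₂ ⊆ ℚ₂` iff its 2-adic norm is at most 1. -/
def IsIntegral2 (c : ℚ_[2]) : Prop := ‖c‖ ≤ 1

/-- A lattice in a `ℚ₂`-vector space `V`: a finitely generated `ℤ₂`-submodule
that spans `V` over `ℚ₂`. -/
def IsLattice {V : Type*} [AddCommGroup V] [Module ℚ_[2] V] [Module ℤ_[2] V]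
    [IsScalarTower ℤ_[2] ℚ_[2] V] (L : Submodule ℤ_[2] V) : Prop :=
  L.FG ∧ Submodule.span ℚ_[2] (L : Set V) = ⊤

/-- `x` lies in the dual lattice `L* = {x ∈ V : B_q(x, L) ⊆ ℤ₂}` of `L`. -/
def InDual {V : Type*} [AddCommGroup V] [Module ℚ_[2] V] [Module ℤ_[2] V]
    [IsScalarTower ℤ_[2] ℚ_[2] V] (q : QuadraticForm ℚ_[2] V) (L : Submodule ℤ_[2] V)
    (x : V) : Prop :=
  ∀ y ∈ L, IsIntegral2 (Bq q x y)

/-- `L` is unimodular: the dual lattice `L*` equals `L`. -/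
def IsUnimodular {V : Type*} [AddCommGroup V] [Module ℚ_[2] V] [Module ℤ_[2] V]
    [IsScalarTower ℤ_[2] ℚ_[2] V] (q : QuadraticForm ℚ_[2] V) (L : Submodule ℤ_[2] V) : Prop :=
  ∀ x : V, InDual q L x ↔ x ∈ L

/-- A lattice `L` is even when `q(L) ⊆ 2ℤ₂`; a unimodular lattice is odd when it is not even. -/
def IsEvenLat {V : Type*} [AddCommGroup V] [Module ℚ_[2] V] [Module ℤ_[2] V]
    [IsScalarTower ℤ_[2] ℚ_[2] V] (q : QuadraticForm ℚ_[2] V) (L : Submodule ℤ_[2] V) : Prop :=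
  ∀ x ∈ L, IsIntegral2 (q x / 2)

namespace IsIntegral2

lemma add {a b : ℚ_[2]} (ha : IsIntegral2 a) (hb : IsIntegral2 b) : IsIntegral2 (a + b) :=
  (Padic.nonarchimedean a b).trans (max_le ha hb)

lemma neg {a : ℚ_[2]} (ha : IsIntegral2 a) : IsIntegral2 (-a) := by
  simpa [IsIntegral2] using ha

lemma sub {a b : ℚ_[2]} (ha : IsIntegral2 a) (hb : IsIntegral2 b) : IsIntegral2 (a - b) := by
  simpa [sub_eq_add_neg] using ha.add hb.neg

lemma mul {a b : ℚ_[2]} (ha : IsIntegral2 a) (hb : IsIntegral2 b) : IsIntegral2 (a * b) := by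
  simpa [IsIntegral2] using mul_le_one₀ ha (norm_nonneg b) hb

lemma two : IsIntegral2 2 := by
  simpa [IsIntegral2] using Padic.norm_int_le_one (p := 2) 2

/-- A 2-adic integer that is not divisible by 2 is a unit. -/
lemma norm_eq_one {c : ℚ_[2]} (hc : IsIntegral2 c) (hc2 : ¬ IsIntegral2 (c / 2)) : ‖c‖ = 1 := by
  by_contra h
  have hlt : ‖(show ℤ_[2] from ⟨c, hc⟩)‖ < 1 := lt_of_le_of_ne hc h
  obtain ⟨y, hy⟩ := (PadicInt.norm_lt_one_iff_dvd _).1 hlt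
  have hcy : c = 2 * (y : ℚ_[2]) := by
    have h := congrArg ((↑) : ℤ_[2] → ℚ_[2]) hy
    rw [PadicInt.coe_mul, PadicInt.coe_natCast] at h
    exact h
  apply hc2
  have : c / 2 = y := by rw [hcy]; ring
  rw [this]
  exact y.2

/-- An odd 2-adic integer is congruent to 1 modulo 2. -/
lemma sub_one_half {c : ℚ_[2]} (hc : IsIntegral2 c) (hc2 : ¬ IsIntegral2 (c / 2)) :
    IsIntegral2 ((c - 1) / 2) := by
  obtain ⟨n, hn, hmem⟩ := PadicInt.exists_mem_range (show ℤ_[2] from ⟨c, hc⟩)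
  rw [PadicInt.maximalIdeal_eq_span_p, Ideal.mem_span_singleton] at hmem
  obtain ⟨y, hy⟩ := hmem
  have hcy : c - n = 2 * (y : ℚ_[2]) := by
    have h := congrArg ((↑) : ℤ_[2] → ℚ_[2]) hy
    rw [PadicInt.coe_sub, PadicInt.coe_mul, PadicInt.coe_natCast, PadicInt.coe_natCast] at h
    exact h
  have hy' : (c - n) / 2 = y := by rw [hcy]; ring
  have hint : IsIntegral2 ((c - n) / 2) := by rw [hy']; exact y.2
  interval_cases n
  · exact absurd (by simpa using hint) hc2
  · simpa using hint

lemma not_half_one : ¬ IsIntegral2 ((1 : ℚ_[2]) / 2) := by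
  have : ‖(2 : ℚ_[2])‖ = 2⁻¹ := by simpa using Padic.norm_p (p := 2)
  simp [IsIntegral2, this]

/-- A 2-adic number congruent to 1 modulo 2 is a unit. -/
lemma norm_eq_one_of_sub_one_half {c : ℚ_[2]} (h : IsIntegral2 ((c - 1) / 2)) : ‖c‖ = 1 := by
  apply norm_eq_one
  · have : c = (c - 1) / 2 * 2 + 1 := by ring
    rw [this]
    exact (h.mul two).add (by simp [IsIntegral2])
  · intro hc
    apply not_half_one
    have : (1 : ℚ_[2]) / 2 = c / 2 - (c - 1) / 2 := by ring
    rw [this]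
    exact hc.sub h

end IsIntegral2

section Lattices

variable {V : Type*} [AddCommGroup V] [Module ℚ_[2] V] (q : QuadraticForm ℚ_[2] V)

lemma polar_eq_two_mul_Bq (x y : V) : QuadraticMap.polar q x y = 2 * Bq q x y := by
  simp only [QuadraticMap.polar, Bq]; ring

lemma Bq_comm (x y : V) : Bq q x y = Bq q y x := by
  simp only [Bq, add_comm x y]; ring

lemma Bq_self (x : V) : Bq q x x = q x := by
  have := polar_eq_two_mul_Bq q x x
  rw [QuadraticMap.polar_self, two_nsmul] at this
  linear_combination -this / 2

lemma Bq_add_right (x y z : V) : Bq q x (y + z) = Bq q x y + Bq q x z := by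
  have := QuadraticMap.polar_add_right q x y z
  simp only [polar_eq_two_mul_Bq] at this
  linear_combination this / 2

lemma Bq_smul_right (a : ℚ_[2]) (x y : V) : Bq q x (a • y) = a * Bq q x y := by
  have := QuadraticMap.polar_smul_right q a x y
  simp only [polar_eq_two_mul_Bq, smul_eq_mul] at this
  linear_combination this / 2

lemma Bq_sub_right (x y z : V) : Bq q x (y - z) = Bq q x y - Bq q x z := by
  have := Bq_add_right q x (y - z) z
  rw [sub_add_cancel] at this
  linear_combination -this

lemma map_sub_eq (x y : V) : q (x - y) = q x + q y - 2 * Bq q x y := by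
  rw [← Bq_self q (x - y), Bq_sub_right, Bq_comm q _ x, Bq_comm q _ y, Bq_sub_right,
    Bq_sub_right, Bq_self, Bq_self, Bq_comm q y x]
  ring

/-- The reflection `x ↦ x - (2 B_q(x,z) / q(z)) z` in an anisotropic vector `z`. -/
noncomputable def vectorReflection (z : V) (hz : q z ≠ 0) : V ≃ₗ[ℚ_[2]] V :=
  Module.reflection (x := z) (f := (q z)⁻¹ • q.polarBilin z) (by
    simp only [LinearMap.smul_apply, QuadraticMap.polarBilin_apply_apply,
      QuadraticMap.polar_self, two_nsmul, smul_eq_mul]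
    field_simp
    ring)

lemma vectorReflection_apply (z : V) (hz : q z ≠ 0) (x : V) :
    vectorReflection q z hz x = x - (2 * Bq q x z / q z) • z := by
  simp only [vectorReflection, Module.reflection_apply, LinearMap.smul_apply,
    QuadraticMap.polarBilin_apply_apply, polar_eq_two_mul_Bq, smul_eq_mul, Bq_comm q z x]
  congr 2
  ring

lemma map_vectorReflection (z : V) (hz : q z ≠ 0) (x : V) :
    q (vectorReflection q z hz x) = q x := by
  rw [vectorReflection_apply, map_sub_eq, Bq_smul_right, QuadraticMap.map_smul, smul_eq_mul]
  field_simp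
  ring

lemma vectorReflection_involutive (z : V) (hz : q z ≠ 0) :
    Function.Involutive (vectorReflection q z hz) :=
  Module.involutive_reflection _

variable [Module ℤ_[2] V]

/-- An isometry between lattices matches their even parts. -/
lemma image_even_eq {L₁ L₂ : Submodule ℤ_[2] V} (g : V ≃ₗ[ℚ_[2]] V)
    (hg : ∀ x, q (g x) = q x)
    (hgL : ⇑g '' (L₁ : Set V) = (L₂ : Set V)) :
    ⇑g '' {x : V | x ∈ L₁ ∧ IsIntegral2 (q x / 2)} =
      {x : V | x ∈ L₂ ∧ IsIntegral2 (q x / 2)} := by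
  ext y
  constructor
  · rintro ⟨x, ⟨hx, hqx⟩, rfl⟩
    refine ⟨?_, by rwa [hg]⟩
    rw [← SetLike.mem_coe, ← hgL]
    exact ⟨x, hx, rfl⟩
  · rintro ⟨hy, hqy⟩
    rw [← SetLike.mem_coe, ← hgL] at hy
    obtain ⟨x, hx, rfl⟩ := hy
    exact ⟨x, ⟨hx, by rwa [hg] at hqy⟩, rfl⟩

variable [IsScalarTower ℤ_[2] ℚ_[2] V]

lemma IsIntegral2.smul_mem {c : ℚ_[2]} (hc : IsIntegral2 c) {L : Submodule ℤ_[2] V} {x : V}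
    (hx : x ∈ L) : c • x ∈ L := by
  have h := L.smul_mem (show ℤ_[2] from ⟨c, hc⟩) hx
  rwa [← algebraMap_smul ℚ_[2]] at h

variable {q} {L L₁ L₂ : Submodule ℤ_[2] V}

lemma IsUnimodular.integral_Bq (hL : IsUnimodular q L) {x y : V} (hx : x ∈ L) (hy : y ∈ L) :
    IsIntegral2 (Bq q x y) :=
  (hL x).2 hx y hy

lemma IsUnimodular.integral_map (hL : IsUnimodular q L) {x : V} (hx : x ∈ L) :
    IsIntegral2 (q x) := by
  simpa [Bq_self] using hL.integral_Bq hx hx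

lemma two_smul_mem_even (hL : IsUnimodular q L) {x : V} (hx : x ∈ L) :
    (2 : ℚ_[2]) • x ∈ L ∧ IsIntegral2 (q ((2 : ℚ_[2]) • x) / 2) := by
  refine ⟨IsIntegral2.two.smul_mem hx, ?_⟩
  rw [QuadraticMap.map_smul, smul_eq_mul]
  have : (2 : ℚ_[2]) * 2 * q x / 2 = 2 * q x := by ring
  rw [this]
  exact IsIntegral2.two.mul (hL.integral_map hx)

/-- The even part of a unimodular lattice has index at most 2. -/
lemma IsUnimodular.sub_even (hL : IsUnimodular q L) {x u : V} (hx : x ∈ L) (hu : u ∈ L)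
    (hqx : ¬ IsIntegral2 (q x / 2)) (hqu : ¬ IsIntegral2 (q u / 2)) :
    IsIntegral2 (q (x - u) / 2) := by
  have : q (x - u) / 2 = (q x - 1) / 2 + (q u - 1) / 2 + 1 - Bq q x u := by
    rw [map_sub_eq]; ring
  rw [this]
  exact ((((hL.integral_map hx).sub_one_half hqx).add
    ((hL.integral_map hu).sub_one_half hqu)).add (by simp [IsIntegral2])).sub
    (hL.integral_Bq hx hu)

/-- Odd vectors of two unimodular lattices with the same even part pair to half a unit, unless
they lie in both lattices. -/
lemma Bq_not_integral (h₁ : IsUnimodular q L₁)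
    (hΛ : ∀ x, (x ∈ L₁ ∧ IsIntegral2 (q x / 2)) ↔ (x ∈ L₂ ∧ IsIntegral2 (q x / 2)))
    (h₂ : IsUnimodular q L₂) {u v : V} (hu : u ∈ L₁) (hv : v ∈ L₂)
    (hqu : ¬ IsIntegral2 (q u / 2)) (hv' : v ∉ L₁) : ¬ IsIntegral2 (Bq q u v) := by
  intro hB
  refine hv' ((h₁ v).1 fun y hy ↦ ?_)
  by_cases hqy : IsIntegral2 (q y / 2)
  · exact h₂.integral_Bq hv ((hΛ y).1 ⟨hy, hqy⟩).1
  · have hyu := ((hΛ (y - u)).1 ⟨L₁.sub_mem hy hu, h₁.sub_even hy hu hqy hqu⟩).1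
    rw [← sub_add_cancel y u, Bq_add_right, Bq_comm q v u]
    exact (h₂.integral_Bq hv hyu).add hB

/-- The norm of the difference of such vectors is a unit. -/
lemma norm_map_sub_eq_one (h₁ : IsUnimodular q L₁) (h₂ : IsUnimodular q L₂)
    (hΛ : ∀ x, (x ∈ L₁ ∧ IsIntegral2 (q x / 2)) ↔ (x ∈ L₂ ∧ IsIntegral2 (q x / 2)))
    {u v : V} (hu : u ∈ L₁) (hv : v ∈ L₂)
    (hqu : ¬ IsIntegral2 (q u / 2)) (hqv : ¬ IsIntegral2 (q v / 2)) (hv' : v ∉ L₁) :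
    ‖q (u - v)‖ = 1 := by
  have hB : IsIntegral2 (2 * Bq q u v) := by
    rw [← Bq_smul_right]
    exact h₁.integral_Bq hu ((hΛ _).2 (two_smul_mem_even h₂ hv)).1
  have hB2 : ¬ IsIntegral2 (2 * Bq q u v / 2) := by
    rw [mul_div_cancel_left₀ _ two_ne_zero]
    exact Bq_not_integral h₁ hΛ h₂ hu hv hqu hv'
  apply IsIntegral2.norm_eq_one_of_sub_one_half
  have : (q (u - v) - 1) / 2 =
      (q u - 1) / 2 + (q v - 1) / 2 - (2 * Bq q u v - 1) / 2 := by
    rw [map_sub_eq]; ring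
  rw [this]
  exact (((h₁.integral_map hu).sub_one_half hqu).add
    ((h₂.integral_map hv).sub_one_half hqv)).sub (hB.sub_one_half hB2)

/-- The reflection in the difference of such vectors maps the first lattice into the second. -/
lemma vectorReflection_mem (h₁ : IsUnimodular q L₁) (h₂ : IsUnimodular q L₂)
    (hΛ : ∀ x, (x ∈ L₁ ∧ IsIntegral2 (q x / 2)) ↔ (x ∈ L₂ ∧ IsIntegral2 (q x / 2)))
    {u v : V} (hu : u ∈ L₁) (hv : v ∈ L₂)
    (hqu : ¬ IsIntegral2 (q u / 2)) (hqv : ¬ IsIntegral2 (q v / 2))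
    (hz1 : ‖q (u - v)‖ = 1) (hz : q (u - v) ≠ 0) {x : V} (hx : x ∈ L₁) :
    vectorReflection q (u - v) hz x ∈ L₂ := by
  have hinv : IsIntegral2 (q (u - v))⁻¹ := by simp [IsIntegral2, hz1]
  have h2u : (2 : ℚ_[2]) • u ∈ L₂ := ((hΛ _).1 (two_smul_mem_even h₁ hu)).1
  have heven : ∀ y ∈ L₁, IsIntegral2 (q y / 2) → vectorReflection q (u - v) hz y ∈ L₂ := by
    intro y hy hqy
    have hy2 : y ∈ L₂ := ((hΛ y).1 ⟨hy, hqy⟩).1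
    have hB : IsIntegral2 (Bq q y (u - v)) := by
      rw [Bq_sub_right]
      exact (h₁.integral_Bq hy hu).sub (h₂.integral_Bq hy2 hv)
    have h2z : (2 : ℚ_[2]) • (u - v) ∈ L₂ := by
      rw [smul_sub]
      exact L₂.sub_mem h2u (IsIntegral2.two.smul_mem hv)
    have : vectorReflection q (u - v) hz y =
        y - (Bq q y (u - v) * (q (u - v))⁻¹) • (2 : ℚ_[2]) • (u - v) := by
      rw [vectorReflection_apply, smul_smul]
      congr 2
      ring
    rw [this]
    exact L₂.sub_mem hy2 ((hB.mul hinv).smul_mem h2z)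
  have hodd : vectorReflection q (u - v) hz u ∈ L₂ := by
    set e : ℚ_[2] := ((q v - 1) / 2 - (q u - 1) / 2) * (q (u - v))⁻¹ with he
    have hei : IsIntegral2 e := (((h₂.integral_map hv).sub_one_half hqv).sub
      ((h₁.integral_map hu).sub_one_half hqu)).mul hinv
    have hcoef : 2 * Bq q u (u - v) / q (u - v) = 1 - e * 2 := by
      rw [he, eq_sub_iff_add_eq]
      field_simp
      rw [map_sub_eq, Bq_sub_right, Bq_self]
      ring
    have : vectorReflection q (u - v) hz u = e • (2 : ℚ_[2]) • u + (1 - e * 2) • v := by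
      rw [vectorReflection_apply, hcoef]
      module
    rw [this]
    exact L₂.add_mem (hei.smul_mem h2u)
      (((show IsIntegral2 1 by simp [IsIntegral2]).sub (hei.mul .two)).smul_mem hv)
  by_cases hqx : IsIntegral2 (q x / 2)
  · exact heven x hx hqx
  · rw [← sub_add_cancel x u, map_add]
    exact L₂.add_mem (heven _ (L₁.sub_mem hx hu) (h₁.sub_even hx hu hqx hqu)) hodd

/-- Unimodular lattices with the same even part, neither containing the other, are isometric. -/
lemma exists_isometry_image_eq (h₁ : IsUnimodular q L₁) (h₂ : IsUnimodular q L₂)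
    (hΛ : ∀ x, (x ∈ L₁ ∧ IsIntegral2 (q x / 2)) ↔ (x ∈ L₂ ∧ IsIntegral2 (q x / 2)))
    {u v : V} (hu : u ∈ L₁) (hu' : u ∉ L₂) (hv : v ∈ L₂) (hv' : v ∉ L₁) :
    ∃ g : V ≃ₗ[ℚ_[2]] V, (∀ x : V, q (g x) = q x) ∧ ⇑g '' (L₁ : Set V) = (L₂ : Set V) := by
  have hqu : ¬ IsIntegral2 (q u / 2) := fun h ↦ hu' ((hΛ u).1 ⟨hu, h⟩).1
  have hqv : ¬ IsIntegral2 (q v / 2) := fun h ↦ hv' ((hΛ v).2 ⟨hv, h⟩).1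
  have hz1 := norm_map_sub_eq_one h₁ h₂ hΛ hu hv hqu hqv hv'
  have hz : q (u - v) ≠ 0 := by
    intro h
    simp [h] at hz1
  refine ⟨vectorReflection q (u - v) hz, map_vectorReflection q _ hz, ?_⟩
  have hswap : q (v - u) = q (u - v) := by rw [← neg_sub, QuadraticMap.map_neg]
  have hback : ∀ y ∈ L₂, vectorReflection q (u - v) hz y ∈ L₁ := by
    intro y hy
    have h := vectorReflection_mem h₂ h₁ (fun x ↦ (hΛ x).symm) hv hu hqv hqu
      (hswap ▸ hz1) (hswap ▸ hz) hy
    have heq : vectorReflection q (v - u) (hswap ▸ hz) y = vectorReflection q (u - v) hz y := by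
      rw [vectorReflection_apply, vectorReflection_apply, hswap, Bq_sub_right, Bq_sub_right]
      module
    rwa [heq] at h
  apply Set.Subset.antisymm
  · rintro _ ⟨x, hx, rfl⟩
    exact vectorReflection_mem h₁ h₂ hΛ hu hv hqu hqv hz1 hz hx
  · intro y hy
    exact ⟨_, hback y hy, vectorReflection_involutive q _ hz y⟩

lemma IsUnimodular.eq_of_le (h₁ : IsUnimodular q L₁) (h₂ : IsUnimodular q L₂) (h : L₁ ≤ L₂) :
    L₁ = L₂ :=
  le_antisymm h fun x hx ↦ (h₁ x).1 fun _ hy ↦ h₂.integral_Bq hx (h hy)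

end Lattices

/-- Let `L₁, L₂` be odd unimodular lattices in `(V, q)` over `ℚ₂` (`dim V ≥ 3`), with
`Λᵢ = {x ∈ Lᵢ : q(x) ∈ 2ℤ₂}`. Every isometry `g` of `(V, q)` with `g(L₁) = L₂` satisfies
`g(Λ₁) = Λ₂`; consequently, if `Λ₁ = Λ₂ = Λ`, then some isometry `g` of `(V, q)` satisfies
`g(Λ) = Λ` and `g(L₁) = L₂`. -/
theorem isometry_matches_kernels
    {V : Type*} [AddCommGroup V] [Module ℚ_[2] V] [Module ℤ_[2] V]
    [IsScalarTower ℤ_[2] ℚ_[2] V] [FiniteDimensional ℚ_[2] V]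
    (d : ℕ) (hd : 3 ≤ d) (hdim : Module.finrank ℚ_[2] V = d)
    (q : QuadraticForm ℚ_[2] V)
    (hnd : ∀ x : V, (∀ y : V, Bq q x y = 0) → x = 0)
    (L₁ L₂ : Submodule ℤ_[2] V) (hL₁ : IsLattice L₁) (hL₂ : IsLattice L₂)
    (hL₁u : IsUnimodular q L₁) (hL₂u : IsUnimodular q L₂)
    (hL₁odd : ¬ IsEvenLat q L₁) (hL₂odd : ¬ IsEvenLat q L₂) :
    (∀ g : V ≃ₗ[ℚ_[2]] V, (∀ x : V, q (g x) = q x) →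
      ⇑g '' (L₁ : Set V) = (L₂ : Set V) →
      ⇑g '' {x : V | x ∈ L₁ ∧ IsIntegral2 (q x / 2)} =
        {x : V | x ∈ L₂ ∧ IsIntegral2 (q x / 2)}) ∧
    ({x : V | x ∈ L₁ ∧ IsIntegral2 (q x / 2)} = {x : V | x ∈ L₂ ∧ IsIntegral2 (q x / 2)} →
      ∃ g : V ≃ₗ[ℚ_[2]] V, (∀ x : V, q (g x) = q x) ∧
        ⇑g '' {x : V | x ∈ L₁ ∧ IsIntegral2 (q x / 2)} =
          {x : V | x ∈ L₁ ∧ IsIntegral2 (q x / 2)} ∧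
        ⇑g '' (L₁ : Set V) = (L₂ : Set V)) := by
  refine ⟨fun g hg hgL ↦ image_even_eq q g hg hgL, fun hΛ ↦ ?_⟩
  obtain ⟨g, hg, hgL⟩ : ∃ g : V ≃ₗ[ℚ_[2]] V, (∀ x : V, q (g x) = q x) ∧
      ⇑g '' (L₁ : Set V) = (L₂ : Set V) := by
    by_cases h12 : L₁ ≤ L₂
    · exact ⟨.refl _ _, by simp, (Set.image_id _).trans (by rw [hL₁u.eq_of_le hL₂u h12])⟩
    by_cases h21 : L₂ ≤ L₁
    · exact absurd (hL₂u.eq_of_le hL₁u h21).ge h12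
    obtain ⟨u, hu, hu'⟩ := SetLike.not_le_iff_exists.1 h12
    obtain ⟨v, hv, hv'⟩ := SetLike.not_le_iff_exists.1 h21
    exact exists_isometry_image_eq hL₁u hL₂u (Set.ext_iff.1 hΛ) hu hu' hv hv'
  exact ⟨g, hg, (image_even_eq q g hg hgL).trans hΛ.symm, hgL⟩
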